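/- arXiv:2411.06169 — 2 statements merged into one kernel-verified Lean document; each statement's English description precedes it below -/
import Mathlib

section
/- Let A, B, a, b > 0 and let p, q, η be real with 1 ≤ p ≤ q < 2 < η. Define Q_n(t) = (A t² − B t^η)/(a t^p + b t^q) and Q_e(t) = ((1/2)A t² − (B/η) t^η)/((a/p) t^p + (b/q) t^q) for t > 0. Then for every t > 0: Q_n(t) > Q_e(t) if and only if Q_e'(t) > 0; Q_n(t) < Q_e(t) if and only if Q_e'(t) < 0; and Q_n(t) = Q_e(t) if and only if Q_e'(t) = 0. -/
/-- The derivative of the scaled power `(c / r) x ^ r`, with the factor `x⁻¹` kept apart. -/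
lemma hasDerivAt_div_mul_rpow (c : ℝ) {r t : ℝ} (hr : r ≠ 0) (ht : 0 < t) :
    HasDerivAt (fun x : ℝ => c / r * x ^ r) (c * t ^ r / t) t := by
  refine ((Real.hasDerivAt_rpow_const (p := r) (Or.inl ht.ne')).const_mul (c / r)).congr_deriv ?_
  rw [Real.rpow_sub_one ht.ne']
  field_simp

/-- If `N' = n / t` and `D' = d / t` at `t`, then `n / d - N / D` is `t * D / d` times the
derivative of `N / D`. -/
lemma div_sub_div_eq_mul_deriv_div {N D : ℝ → ℝ} {n d t : ℝ}
    (hN : HasDerivAt N (n / t) t) (hD : HasDerivAt D (d / t) t)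
    (ht : t ≠ 0) (hd : d ≠ 0) (hDt : D t ≠ 0) :
    n / d - N t / D t = t * D t / d * deriv (fun x => N x / D x) t := by
  rw [(hN.fun_div hD hDt).deriv]
  field_simp


/-- Remark 2.9 (lema_naru) in abstract fibering form: with `A, B, a, b > 0` and
`1 ≤ p ≤ q < 2 < η`, for `Q_n(t) = (A t² − B t^η)/(a t^p + b t^q)` and
`Q_e(t) = ((1/2)A t² − (B/η) t^η)/((a/p) t^p + (b/q) t^q)` one has, for every
`t > 0`: `Q_n(t) > Q_e(t) ↔ Q_e'(t) > 0`, `Q_n(t) < Q_e(t) ↔ Q_e'(t) < 0`, and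
`Q_n(t) = Q_e(t) ↔ Q_e'(t) = 0`. -/
theorem stmt_11 (A B a b p q η : ℝ) (hA : 0 < A) (hB : 0 < B) (ha : 0 < a) (hb : 0 < b)
    (hp : 1 ≤ p) (hpq : p ≤ q) (hq : q < 2) (hη : 2 < η)
    (Qn Qe : ℝ → ℝ)
    (hQn : ∀ t : ℝ, Qn t = (A * t ^ (2 : ℝ) - B * t ^ η) / (a * t ^ p + b * t ^ q))
    (hQe : ∀ t : ℝ, Qe t =
      ((1 / 2) * A * t ^ (2 : ℝ) - (B / η) * t ^ η) / ((a / p) * t ^ p + (b / q) * t ^ q)) :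
    ∀ t : ℝ, 0 < t →
      (Qn t > Qe t ↔ deriv Qe t > 0) ∧
      (Qn t < Qe t ↔ deriv Qe t < 0) ∧
      (Qn t = Qe t ↔ deriv Qe t = 0) := by
  intro t ht
  have hp0 : 0 < p := by linarith
  have hq0 : 0 < q := by linarith
  have hη0 : η ≠ 0 := by linarith
  have hN : HasDerivAt (fun x : ℝ => 1 / 2 * A * x ^ (2 : ℝ) - B / η * x ^ η)
      ((A * t ^ (2 : ℝ) - B * t ^ η) / t) t := by
    rw [sub_div, one_div_mul_eq_div]
    exact (hasDerivAt_div_mul_rpow A two_ne_zero ht).fun_sub (hasDerivAt_div_mul_rpow B hη0 ht)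
  have hD : HasDerivAt (fun x : ℝ => a / p * x ^ p + b / q * x ^ q)
      ((a * t ^ p + b * t ^ q) / t) t := by
    rw [add_div]
    exact (hasDerivAt_div_mul_rpow a hp0.ne' ht).fun_add (hasDerivAt_div_mul_rpow b hq0.ne' ht)
  have hd : 0 < a * t ^ p + b * t ^ q := by positivity
  have hDt : 0 < a / p * t ^ p + b / q * t ^ q := by positivity
  have hdiff := div_sub_div_eq_mul_deriv_div hN hD ht.ne' hd.ne' hDt.ne'
  have hc : 0 < t * (a / p * t ^ p + b / q * t ^ q) / (a * t ^ p + b * t ^ q) := by positivity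
  rw [← funext hQe, ← hQn, ← hQe] at hdiff
  refine ⟨?_, ?_, ?_⟩
  · rw [gt_iff_lt, ← sub_pos, hdiff, mul_pos_iff_of_pos_left hc]
  · rw [← sub_neg, hdiff, ← smul_eq_mul, smul_neg_iff_of_pos_left hc]
  · rw [← sub_eq_zero, hdiff, mul_eq_zero_iff_left hc.ne']
end

section
/- Let A, B, a, b > 0 and let p, q, η be real with 1 ≤ p ≤ q < 2 < η. Set Q_n(t) = (A t² − B t^η)/(a t^p + b t^q), λ* = sup_{t>0} Q_n(t), and for λ ∈ (0, λ*) define γ_λ(t) = (A/2)t² − λ(a/p)t^p − λ(b/q)t^q − (B/η)t^η for t > 0. Then γ_λ has exactly two critical points 0 < t⁺ < t⁻ in (0,∞); moreover t⁺ is a local minimum point of γ_λ and t⁻ is a local maximum point of γ_λ. -/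
/-- A continuous concave function on `ℝ` which is positive at a point and negative on both sides
of it has exactly two zeros, is negative outside of them and positive in between. -/
lemma ConcaveOn.exists_two_zeros {g : ℝ → ℝ} (hg : ConcaveOn ℝ Set.univ g) (hc : Continuous g)
    {l m r : ℝ} (hlm : l < m) (hmr : m < r) (hl : g l < 0) (hm : 0 < g m) (hr : g r < 0) :
    ∃ x y : ℝ, x < y ∧ g x = 0 ∧ g y = 0 ∧ (∀ s < x, g s < 0) ∧
      (∀ s, x < s → s < y → 0 < g s) ∧ (∀ s, y < s → g s < 0) := by
  obtain ⟨x, ⟨-, hxm⟩, hx⟩ := intermediate_value_Ioo hlm.le hc.continuousOn ⟨hl, hm⟩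
  obtain ⟨y, ⟨hmy, -⟩, hy⟩ := intermediate_value_Ioo' hmr.le hc.continuousOn ⟨hr, hm⟩
  have chord : ∀ u v w : ℝ, u < v → v < w → (w - v) * g u + (v - u) * g w ≤ (w - u) * g v := by
    intro u v w huv hvw
    have h := hg.slope_anti_adjacent (Set.mem_univ u) (Set.mem_univ w) huv hvw
    rw [div_le_div_iff₀ (sub_pos.2 hvw) (sub_pos.2 huv)] at h
    linarith
  refine ⟨x, y, hxm.trans hmy, hx, hy, fun s hs => ?_, fun s hxs hsy => ?_, fun s hs => ?_⟩
  · have h := chord s x m hs hxm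
    rw [hx] at h
    by_contra! hn
    nlinarith [mul_pos (sub_pos.2 hs) hm, mul_nonneg (sub_pos.2 hxm).le hn]
  · rcases lt_trichotomy s m with hsm | rfl | hms
    · have h := chord x s m hxs hsm
      rw [hx] at h
      by_contra! hn
      nlinarith [mul_pos (sub_pos.2 hxs) hm, mul_nonneg (sub_pos.2 hxm).le (neg_nonneg.2 hn)]
    · exact hm
    · have h := chord m s y hms hsy
      rw [hy] at h
      by_contra! hn
      nlinarith [mul_pos (sub_pos.2 hsy) hm, mul_nonneg (sub_pos.2 hmy).le (neg_nonneg.2 hn)]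
  · have h := chord m y s hmy hs
    rw [hy] at h
    by_contra! hn
    nlinarith [mul_pos (sub_pos.2 hs) hm, mul_nonneg (sub_pos.2 hmy).le hn]

/-- Scaled exponentials `s ↦ c * exp (k * s)` with `0 ≤ c` are convex. -/
lemma convexOn_const_mul_exp_mul {c : ℝ} (hc : 0 ≤ c) (k : ℝ) :
    ConvexOn ℝ Set.univ fun s : ℝ => c * Real.exp (k * s) := by
  simpa using (convexOn_exp.comp_linearMap (LinearMap.mulLeft ℝ k)).smul hc

/-- The function `s ↦ A - c₁ exp (k₁ s) - c₂ exp (k₂ s) - c₃ exp (k₃ s)` with `k₁ < 0 < k₃` and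
positive coefficients has exactly two sign changes as soon as it is positive somewhere. -/
lemma exists_two_zeros_sub_exp {A c₁ c₂ c₃ k₁ k₂ k₃ m : ℝ} (hA : 0 < A) (h₁ : 0 < c₁)
    (h₂ : 0 < c₂) (h₃ : 0 < c₃) (hk₁ : k₁ < 0) (hk₃ : 0 < k₃) {g : ℝ → ℝ}
    (hg : g = fun s => A - (c₁ * Real.exp (k₁ * s) + c₂ * Real.exp (k₂ * s) +
      c₃ * Real.exp (k₃ * s))) (hm : 0 < g m) :
    ∃ x y : ℝ, x < y ∧ g x = 0 ∧ g y = 0 ∧ (∀ s < x, g s < 0) ∧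
      (∀ s, x < s → s < y → 0 < g s) ∧ (∀ s, y < s → g s < 0) := by
  have hconc : ConcaveOn ℝ Set.univ g := by
    rw [hg]
    exact (concaveOn_const A convex_univ).sub
      (((convexOn_const_mul_exp_mul h₁.le k₁).add (convexOn_const_mul_exp_mul h₂.le k₂)).add
        (convexOn_const_mul_exp_mul h₃.le k₃))
  have hcont : Continuous g := by rw [hg]; fun_prop
  have hpos : ∀ {c : ℝ} (k s : ℝ), 0 < c → 0 < c * Real.exp (k * s) := fun k s hc =>
    mul_pos hc (Real.exp_pos _)
  have hlog : ∀ {c k s : ℝ}, 0 < c → Real.log (A / c) ≤ k * s → A ≤ c * Real.exp (k * s) := by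
    intro c k s hc h
    rw [Real.log_le_iff_le_exp (div_pos hA hc), div_le_iff₀ hc] at h
    linarith
  have hleft : ∀ s ≤ Real.log (A / c₁) / k₁, g s < 0 := by
    intro s hs
    rw [le_div_iff_of_neg hk₁, mul_comm] at hs
    rw [hg]
    linarith [hlog h₁ hs, hpos k₂ s h₂, hpos k₃ s h₃]
  have hright : ∀ s ≥ Real.log (A / c₃) / k₃, g s < 0 := by
    intro s hs
    rw [ge_iff_le, div_le_iff₀ hk₃, mul_comm] at hs
    rw [hg]
    linarith [hlog h₃ hs, hpos k₂ s h₂, hpos k₁ s h₁]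
  exact hconc.exists_two_zeros hcont (lt_of_not_ge fun h => (hleft m h).not_gt hm)
    (lt_of_not_ge fun h => (hright m h).not_gt hm) (hleft _ le_rfl) hm (hright _ le_rfl)

/-- Proposition 2.20 (tn-,tn+, item i) in abstract fibering form: with
`A, B, a, b > 0` and `1 ≤ p ≤ q < 2 < η`, set
`Q_n(t) = (A t² − B t^η)/(a t^p + b t^q)` and `λ* = sup_{t>0} Q_n(t)`. For each
`λ ∈ (0, λ*)`, the fibering map
`γ_λ(t) = (A/2)t² − λ(a/p)t^p − λ(b/q)t^q − (B/η)t^η` has exactly two critical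
points `0 < t⁺ < t⁻` in `(0,∞)`; moreover `t⁺` is a local minimum point and
`t⁻` is a local maximum point of `γ_λ`. -/
theorem stmt_18 (A B a b p q η : ℝ) (hA : 0 < A) (hB : 0 < B) (ha : 0 < a) (hb : 0 < b)
    (hp : 1 ≤ p) (hpq : p ≤ q) (hq : q < 2) (hη : 2 < η)
    (Qn : ℝ → ℝ)
    (hQn : ∀ t : ℝ, Qn t = (A * t ^ (2 : ℝ) - B * t ^ η) / (a * t ^ p + b * t ^ q))
    (lam : ℝ) (hlam0 : 0 < lam) (hlam : lam < sSup (Qn '' Set.Ioi 0))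
    (γ : ℝ → ℝ)
    (hγ : ∀ t : ℝ, γ t = (A / 2) * t ^ (2 : ℝ) - lam * (a / p) * t ^ p -
      lam * (b / q) * t ^ q - (B / η) * t ^ η) :
    ∃ tp tm : ℝ, 0 < tp ∧ tp < tm ∧ deriv γ tp = 0 ∧ deriv γ tm = 0 ∧
      (∀ t : ℝ, 0 < t → deriv γ t = 0 → (t = tp ∨ t = tm)) ∧
      IsLocalMin γ tp ∧ IsLocalMax γ tm := by
  have hrpow : ∀ {t : ℝ}, 0 < t → ∀ r : ℝ,
      t ^ r = t ^ (2 : ℝ) * Real.exp ((r - 2) * Real.log t) := by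
    intro t ht r
    rw [mul_comm (r - 2), ← Real.rpow_def_of_pos ht, ← Real.rpow_add ht]
    congr 1
    ring
  obtain ⟨g, hg⟩ : ∃ g : ℝ → ℝ, g = fun s => A - (lam * a * Real.exp ((p - 2) * s) +
      lam * b * Real.exp ((q - 2) * s) + B * Real.exp ((η - 2) * s)) := ⟨_, rfl⟩
  have hderiv : ∀ t : ℝ, 0 < t → HasDerivAt γ (t * g (Real.log t)) t := by
    intro t ht
    have h := fun r : ℝ => Real.hasDerivAt_rpow_const (x := t) (p := r) (Or.inl ht.ne')
    have hsum := ((((h 2).const_mul (A / 2)).sub ((h p).const_mul (lam * (a / p)))).sub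
      ((h q).const_mul (lam * (b / q)))).sub ((h η).const_mul (B / η))
    rw [funext hγ]
    refine hsum.congr_deriv ?_
    have hr : ∀ r : ℝ, t ^ (r - 1) = t * Real.exp ((r - 2) * Real.log t) := by
      intro r
      rw [Real.rpow_sub_one ht.ne', hrpow ht r, Real.rpow_two]
      field_simp
    have hp0 : p ≠ 0 := by linarith
    have hq0 : q ≠ 0 := by linarith
    have hη0 : η ≠ 0 := by linarith
    rw [hg, hr 2, hr p, hr q, hr η, sub_self, zero_mul, Real.exp_zero]
    field_simp
    ring
  obtain ⟨m, hm⟩ : ∃ m, 0 < g m := by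
    obtain ⟨_, ⟨t, ht, rfl⟩, hlt⟩ := exists_lt_of_lt_csSup (Set.nonempty_Ioi.image Qn) hlam
    have ht : 0 < t := ht
    refine ⟨Real.log t, ?_⟩
    rw [hQn, lt_div_iff₀ (by positivity), hrpow ht p, hrpow ht q, hrpow ht η] at hlt
    refine pos_of_mul_pos_right (a := t ^ (2 : ℝ)) ?_ (by positivity)
    rw [hg]
    linarith
  obtain ⟨x, y, hxy, hx, hy, hlt, hmid, hgt⟩ :=
    exists_two_zeros_sub_exp hA (mul_pos hlam0 ha) (mul_pos hlam0 hb) hB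
      (by linarith : p - 2 < 0) (by linarith : 0 < η - 2) hg hm
  have hd : ∀ t : ℝ, 0 < t → deriv γ t = t * g (Real.log t) := fun t ht => (hderiv t ht).deriv
  have hexy := Real.exp_lt_exp.2 hxy
  have hdiff : ∀ u v : ℝ, 0 ≤ u → DifferentiableOn ℝ γ (Set.Ioo u v) := fun u v hu t ht =>
    (hderiv t (hu.trans_lt ht.1)).differentiableAt.differentiableWithinAt
  have hneg_left : ∀ t ∈ Set.Ioo 0 (Real.exp x), deriv γ t ≤ 0 := by
    intro t ht
    rw [hd t ht.1]
    exact mul_nonpos_of_nonneg_of_nonpos ht.1.le (hlt _ ((Real.log_lt_iff_lt_exp ht.1).2 ht.2)).le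
  have hpos_mid : ∀ t ∈ Set.Ioo (Real.exp x) (Real.exp y), 0 ≤ deriv γ t := by
    intro t ht
    have ht0 := (Real.exp_pos x).trans ht.1
    rw [hd t ht0]
    exact mul_nonneg ht0.le (hmid _ ((Real.lt_log_iff_exp_lt ht0).2 ht.1)
      ((Real.log_lt_iff_lt_exp ht0).2 ht.2)).le
  have hneg_right : ∀ t ∈ Set.Ioo (Real.exp y) (Real.exp y + 1), deriv γ t ≤ 0 := by
    intro t ht
    have ht0 := (Real.exp_pos y).trans ht.1
    rw [hd t ht0]
    exact mul_nonpos_of_nonneg_of_nonpos ht0.le (hgt _ ((Real.lt_log_iff_exp_lt ht0).2 ht.1)).le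
  refine ⟨Real.exp x, Real.exp y, Real.exp_pos x, hexy, ?_, ?_, ?_, ?_, ?_⟩
  · rw [hd _ (Real.exp_pos x), Real.log_exp, hx, mul_zero]
  · rw [hd _ (Real.exp_pos y), Real.log_exp, hy, mul_zero]
  · intro t ht h0
    rw [hd t ht, mul_eq_zero, or_iff_right ht.ne'] at h0
    have hz : Real.log t = x ∨ Real.log t = y := by
      by_contra! hne
      rcases hne.1.lt_or_gt with h | h
      · exact (hlt _ h).ne h0
      · rcases hne.2.lt_or_gt with h' | h'
        · exact (hmid _ h h').ne' h0
        · exact (hgt _ h').ne h0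
    rw [← Real.exp_log ht]
    exact hz.imp (congrArg Real.exp) (congrArg Real.exp)
  · exact isLocalMin_of_deriv_Ioo (Real.exp_pos x) hexy (hderiv _ (Real.exp_pos x)).continuousAt
      (hdiff _ _ le_rfl) (hdiff _ _ (Real.exp_pos x).le) hneg_left hpos_mid
  · exact isLocalMax_of_deriv_Ioo hexy (lt_add_one _) (hderiv _ (Real.exp_pos y)).continuousAt
      (hdiff _ _ (Real.exp_pos x).le) (hdiff _ _ (Real.exp_pos y).le) hpos_mid hneg_right
end
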